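/- Richness ratio of RoI-feasible strategies (tightness): for every m ∈ ℕ and every δ ∈ (0, 1/2], there exist positive integers T, K, M, a valuation vector v = (v_1,…,v_M) with v_1 ≥ … ≥ v_M ≥ 0, and a bid history H₋ = (β₋^1,…,β₋^T) such that max_{b' ∈ 𝒫*_{≤m}} ∑_{t=1}^{T} V(b';β₋^t) > 0 and sup_{b ∈ 𝒬_{≤m}(H₋)} ∑_{t=1}^{T} V(b;β₋^t) ≥ (2 − δ) · max_{b' ∈ 𝒫*_{≤m}} ∑_{t=1}^{T} V(b';β₋^t). -/

import Mathlib

open Finset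

namespace Auction

/-- A competing-bid profile for an auction of `K` identical units, represented by the
function sending `j ∈ {1,…,K}` to the `j`-th smallest element of the multiset of the
`K` largest competing bids. -/
structure Profile (K : ℕ) where
  c : ℕ → ℝ
  mono : ∀ i j : ℕ, 1 ≤ i → i ≤ j → j ≤ K → c i ≤ c j
  nonneg : ∀ j : ℕ, 1 ≤ j → j ≤ K → 0 ≤ c j

/-- A bid vector: `n` units are demanded and `bid j` is the bid for the `j`-th unit
(for `1 ≤ j ≤ n`). -/
structure BidVec where
  n : ℕ
  bid : ℕ → ℝ

/-- A bid vector is valid if its bids are non-increasing and positive. -/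
def BidVec.Valid (b : BidVec) : Prop :=
  (∀ i j : ℕ, 1 ≤ i → i ≤ j → j ≤ b.n → b.bid j ≤ b.bid i) ∧
  ∀ j : ℕ, 1 ≤ j → j ≤ b.n → 0 < b.bid j

open Classical in
/-- The number of units the bidder wins (ties broken in the bidder's favor): the
largest `r ≤ min n K` such that the bidder's `j`-th bid is at least the `j`-th
threshold `β.c j` for every `j ≤ r`. -/
noncomputable def alloc (K : ℕ) (b : BidVec) (β : Profile K) : ℕ :=
  ((Finset.Icc 1 (min b.n K)).filter fun r => ∀ j ∈ Finset.Icc 1 r, β.c j ≤ b.bid j).sup id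

/-- The clearing price: the `K`-th highest among all submitted bids (taken to be `0`
when the bidder wins no unit). -/
noncomputable def price (K : ℕ) (b : BidVec) (β : Profile K) : ℝ :=
  if alloc K b β = 0 then 0
  else if alloc K b β < K then min (b.bid (alloc K b β)) (β.c (alloc K b β + 1))
  else b.bid K

/-- The value obtained by the bidder. -/
noncomputable def value (v : ℕ → ℝ) (K : ℕ) (b : BidVec) (β : Profile K) : ℝ :=
  ∑ j ∈ Finset.Icc 1 (alloc K b β), v j

/-- The bidder's total payment. -/
noncomputable def payment (K : ℕ) (b : BidVec) (β : Profile K) : ℝ :=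
  price K b β * (alloc K b β : ℝ)

/-- The RoI constraint (with target RoI `γ = 0`) against a single competing-bid profile. -/
def Feasible (v : ℕ → ℝ) (K : ℕ) (b : BidVec) (β : Profile K) : Prop :=
  payment K b β ≤ value v K b β

/-- A bid vector is safe if it satisfies the RoI constraint against every profile. -/
def Safe (v : ℕ → ℝ) (K : ℕ) (b : BidVec) : Prop :=
  ∀ β : Profile K, Feasible v K b β

/-- A valuation vector: nonnegative and non-increasing on `{1,…,M}`. -/
def ValidValuation (M : ℕ) (v : ℕ → ℝ) : Prop :=
  (∀ j : ℕ, 1 ≤ j → j ≤ M → 0 ≤ v j) ∧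
  ∀ i j : ℕ, 1 ≤ i → i ≤ j → j ≤ M → v j ≤ v i

/-- The average cumulative valuation `w_j = (v_1 + ⋯ + v_j) / j`. -/
noncomputable def w (v : ℕ → ℝ) (j : ℕ) : ℝ :=
  (∑ ℓ ∈ Finset.Icc 1 j, v ℓ) / (j : ℝ)

/-- An `m`-uniform bidding strategy: bid-quantity pairs `(b j, q j)` for `1 ≤ j ≤ m`. -/
structure Uniform where
  m : ℕ
  b : ℕ → ℝ
  q : ℕ → ℕ

/-- Cumulative quantities `Q j = q 1 + ⋯ + q j`. -/
def Uniform.Q (s : Uniform) (j : ℕ) : ℕ := ∑ ℓ ∈ Finset.Icc 1 j, s.q ℓ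

/-- `s` is a genuine `m`-uniform strategy for maximum demand `M`:
`b 1 > b 2 > ⋯ > b m > 0`, positive quantities, and `Q m ≤ M`. -/
def Uniform.IsUniform (M : ℕ) (s : Uniform) : Prop :=
  1 ≤ s.m ∧
  (∀ j : ℕ, 1 ≤ j → j ≤ s.m → 0 < s.q j) ∧
  0 < s.b s.m ∧
  (∀ j : ℕ, 1 ≤ j → j < s.m → s.b (j + 1) < s.b j) ∧
  s.Q s.m ≤ M

/-- The bid vector associated to a uniform strategy: the bid on the `j`-th unit is
`b ℓ`, where `ℓ` is least with `j ≤ Q ℓ`. -/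
noncomputable def Uniform.toBidVec (s : Uniform) : BidVec :=
  ⟨s.Q s.m, fun j => s.b (sInf {ℓ : ℕ | j ≤ s.Q ℓ})⟩

/-- The 1-uniform strategy bidding `b` on `q` units. -/
def single (b : ℝ) (q : ℕ) : Uniform := ⟨1, fun _ => b, fun _ => q⟩

/-- Membership in the class `𝒫*_{≤ m}` of safe undominated strategies with at most `m`
bid-quantity pairs: strategies determined by a tuple `0 < Q 1 < ⋯ < Q k ≤ M` (`k ≤ m`)
via `b ℓ = w (Q ℓ)` and `q ℓ = Q ℓ - Q (ℓ-1)`. -/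
def InSafeClass (M : ℕ) (v : ℕ → ℝ) (m : ℕ) (s : Uniform) : Prop :=
  1 ≤ s.m ∧ s.m ≤ m ∧ (∀ j : ℕ, 1 ≤ j → j ≤ s.m → 0 < s.q j) ∧ s.Q s.m ≤ M ∧
  ∀ ℓ : ℕ, 1 ≤ ℓ → ℓ ≤ s.m → s.b ℓ = w v (s.Q ℓ)

/-- Membership in the class `𝒬_{≤ m}(H)` of strategies with at most `m` bid-quantity
pairs that are RoI-feasible for the bid history `H` over rounds `1,…,T`. -/
def InFeasClass (M : ℕ) (v : ℕ → ℝ) (K T : ℕ) (H : ℕ → Profile K) (m : ℕ) (s : Uniform) : Prop :=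
  s.IsUniform M ∧ s.m ≤ m ∧ ∀ t ∈ Finset.Icc 1 T, Feasible v K s.toBidVec (H t)

/-- Total value obtained by strategy `s` over the bid history `H` on rounds `1,…,T`. -/
noncomputable def totalValue (v : ℕ → ℝ) (K T : ℕ) (H : ℕ → Profile K) (s : Uniform) : ℝ :=
  ∑ t ∈ Finset.Icc 1 T, value v K s.toBidVec (H t)

/-- The optimal total value over the class `𝒫*_{≤ m}`. -/
noncomputable def bestSafe (M : ℕ) (v : ℕ → ℝ) (K T : ℕ) (H : ℕ → Profile K) (m : ℕ) : ℝ :=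
  sSup {x : ℝ | ∃ s : Uniform, InSafeClass M v m s ∧ x = totalValue v K T H s}

/-- The optimal total value over the class `𝒬_{≤ m}(H)`. -/
noncomputable def bestFeas (M : ℕ) (v : ℕ → ℝ) (K T : ℕ) (H : ℕ → Profile K) (m : ℕ) : ℝ :=
  sSup {x : ℝ | ∃ s : Uniform, InFeasClass M v K T H m s ∧ x = totalValue v K T H s}

/-- If the bidder wins at least `j` units, the `j`-th bid meets the `j`-th threshold. -/
lemma le_bid_of_le_alloc {K : ℕ} {b : BidVec} {β : Profile K} {j : ℕ} (h1 : 1 ≤ j)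
    (hj : j ≤ alloc K b β) : β.c j ≤ b.bid j := by
  have hsup : ∀ S : Finset ℕ, S.sup id ≠ 0 → S.sup id ∈ S := fun S hS => by
    have hne : S.Nonempty := by
      rw [Finset.nonempty_iff_ne_empty]
      rintro rfl
      exact hS rfl
    obtain ⟨r, hr, he⟩ := Finset.exists_mem_eq_sup S hne id
    rw [he]
    exact hr
  have hmem := hsup _ (show alloc K b β ≠ 0 by omega)
  simp only [Finset.mem_filter] at hmem
  exact hmem.2 j (Finset.mem_Icc.2 ⟨h1, hj⟩)

lemma alloc_le (K : ℕ) (b : BidVec) (β : Profile K) : alloc K b β ≤ min b.n K := by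
  unfold alloc
  refine Finset.sup_le fun r hr => ?_
  simp only [Finset.mem_filter] at hr
  exact (Finset.mem_Icc.1 hr.1).2

lemma le_alloc {K : ℕ} {b : BidVec} {β : Profile K} {r : ℕ} (hr : r ≤ min b.n K)
    (h : ∀ j, 1 ≤ j → j ≤ r → β.c j ≤ b.bid j) : r ≤ alloc K b β := by
  rcases Nat.eq_zero_or_pos r with rfl | hpos
  · exact Nat.zero_le _
  unfold alloc
  refine Finset.le_sup (f := id) ?_
  simp only [Finset.mem_filter]
  refine ⟨Finset.mem_Icc.2 ⟨hpos, hr⟩, fun j hj => ?_⟩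
  exact h j (Finset.mem_Icc.1 hj).1 (Finset.mem_Icc.1 hj).2

/-- The bid on a demanded unit `j` is `s.b ℓ` for the least `ℓ` with `j ≤ s.Q ℓ`. -/
lemma Uniform.exists_bid_eq (s : Uniform) {j : ℕ} (h1 : 1 ≤ j) (hj : j ≤ s.Q s.m) :
    ∃ ℓ, 1 ≤ ℓ ∧ ℓ ≤ s.m ∧ j ≤ s.Q ℓ ∧ (∀ k, j ≤ s.Q k → ℓ ≤ k) ∧
      s.toBidVec.bid j = s.b ℓ := by
  have hne : {ℓ : ℕ | j ≤ s.Q ℓ}.Nonempty := ⟨s.m, hj⟩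
  have hmem : j ≤ s.Q (sInf {ℓ : ℕ | j ≤ s.Q ℓ}) := Nat.sInf_mem hne
  refine ⟨sInf {ℓ : ℕ | j ≤ s.Q ℓ}, ?_, Nat.sInf_le hj, hmem, fun k hk => Nat.sInf_le hk, rfl⟩
  rw [Nat.one_le_iff_ne_zero]
  intro h0
  rw [h0] at hmem
  simp [Uniform.Q] at hmem
  omega

/-- A sequence of rounds in which type `t ∈ {1,…,N}` occurs exactly `n t` times. -/
lemma exists_schedule (n : ℕ → ℕ) (N : ℕ) :
    ∃ (T : ℕ) (τ : ℕ → ℕ), (∀ i ∈ Finset.Icc 1 T, τ i ∈ Finset.Icc 1 N) ∧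
      ∀ f : ℕ → ℝ, ∑ i ∈ Finset.Icc 1 T, f (τ i) = ∑ t ∈ Finset.Icc 1 N, (n t : ℝ) * f t := by
  induction N with
  | zero => exact ⟨0, id, by simp, by simp⟩
  | succ N ih =>
    obtain ⟨T, τ, hτ, hsum⟩ := ih
    refine ⟨T + n (N + 1), fun i => if i ≤ T then τ i else N + 1, ?_, ?_⟩
    · intro i hi
      rw [Finset.mem_Icc] at hi ⊢
      dsimp only
      split_ifs with h
      · have := Finset.mem_Icc.1 (hτ i (Finset.mem_Icc.2 ⟨hi.1, h⟩))
        omega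
      · omega
    · intro f
      have hrange : ∀ (k : ℕ) (g : ℕ → ℝ),
          ∑ i ∈ Finset.Icc 1 k, g i = ∑ i ∈ Finset.range k, g (1 + i) := by
        intro k g
        rw [← Finset.Ico_add_one_right_eq_Icc, Finset.sum_Ico_eq_sum_range]
        simp
      rw [Finset.sum_Icc_succ_top (by omega), ← hsum, hrange, hrange, Finset.sum_range_add]
      congr 1
      · refine Finset.sum_congr rfl fun i hi => ?_
        dsimp only
        rw [if_pos (by have := Finset.mem_range.1 hi; omega)]
      · rw [Finset.sum_congr rfl (g := fun _ => f (N + 1))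
          (fun i _ => by dsimp only; rw [if_neg (by omega)])]
        simp

/-- The valuation vector `(2, 1, 1, …)`. -/
noncomputable def tightVal (j : ℕ) : ℝ := if j = 1 then 2 else 1

lemma sum_tightVal {r : ℕ} (hr : 1 ≤ r) : ∑ j ∈ Finset.Icc 1 r, tightVal j = (r : ℝ) + 1 := by
  induction r, hr using Nat.le_induction with
  | base => norm_num [tightVal]
  | succ r hr ih =>
    rw [Finset.sum_Icc_succ_top (by omega), ih, tightVal, if_neg (by omega)]
    push_cast
    ring

lemma w_tightVal {r : ℕ} (hr : 1 ≤ r) : w tightVal r = 1 + (r : ℝ)⁻¹ := by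
  have : (r : ℝ) ≠ 0 := by positivity
  rw [w, sum_tightVal hr]
  field_simp

lemma w_tightVal_le_iff {p r : ℕ} (hp : 1 ≤ p) (hr : 1 ≤ r) :
    w tightVal p ≤ w tightVal r ↔ r ≤ p := by
  rw [w_tightVal hp, w_tightVal hr, add_le_add_iff_left, inv_le_inv₀ (by positivity)
    (by positivity), Nat.cast_le]

lemma w_tightVal_pos {r : ℕ} (hr : 1 ≤ r) : 0 < w tightVal r := by
  rw [w_tightVal hr]
  positivity

lemma w_tightVal_le_two (r : ℕ) : w tightVal r ≤ 2 := by
  rcases Nat.eq_zero_or_pos r with rfl | hr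
  · simp [w]
  · rw [w_tightVal hr]
    have := Nat.cast_inv_le_one (α := ℝ) r
    linarith

lemma w_tightVal_nonneg (r : ℕ) : 0 ≤ w tightVal r := by
  rcases Nat.eq_zero_or_pos r with rfl | hr
  · simp [w]
  · exact (w_tightVal_pos hr).le

/-- Competing bids of a round of type `t`: winning `B ^ t - 1` units requires bidding
`w (B ^ t - 1)`; for odd `t` no further unit can be won. -/
noncomputable def tightProfile (K B t : ℕ) : Profile K where
  c j := if Odd t ∧ B ^ t ≤ j then 3 else w tightVal (B ^ t - 1)
  mono i j _ hij _ := by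
    have := w_tightVal_le_two (B ^ t - 1)
    split_ifs with h1 h2
    · exact le_rfl
    · exact absurd ⟨h1.1, h1.2.trans hij⟩ h2
    · linarith
    · exact le_rfl
  nonneg j _ _ := by
    have := w_tightVal_nonneg (B ^ t - 1)
    split_ifs
    · norm_num
    · exact this

lemma w_le_tightProfile (K B t j : ℕ) :
    w tightVal (B ^ t - 1) ≤ (tightProfile K B t).c j := by
  have := w_tightVal_le_two (B ^ t - 1)
  simp only [tightProfile]
  split_ifs
  · linarith
  · exact le_rfl

lemma tightProfile_of_lt {K B t j : ℕ} (h : j < B ^ t) :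
    (tightProfile K B t).c j = w tightVal (B ^ t - 1) := by
  simp only [tightProfile]
  rw [if_neg (by omega)]

lemma one_le_pow_sub_one {B t : ℕ} (hB : 2 ≤ B) (ht : 1 ≤ t) : 1 ≤ B ^ t - 1 := by
  have : B ^ 1 ≤ B ^ t := Nat.pow_le_pow_right (by omega) ht
  rw [pow_one] at this
  omega

/-- A safe strategy gets a substantial value in round `t` only if one of its cumulative
quantities lies in `[B ^ (t - 1), B ^ t)`. -/
lemma value_safe_le {M K B m t : ℕ} {s : Uniform} (hB : 2 ≤ B) (ht : 1 ≤ t)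
    (hs : InSafeClass M tightVal m s) :
    value tightVal K s.toBidVec (tightProfile K B t) ≤ (B : ℝ) ^ (t - 1) +
      if t ∈ (Finset.Icc 1 s.m).image (fun ℓ => Nat.log B (s.Q ℓ) + 1)
      then (B : ℝ) ^ t else 0 := by
  set r := alloc K s.toBidVec (tightProfile K B t) with hr
  have hite : (0 : ℝ) ≤ if t ∈ (Finset.Icc 1 s.m).image (fun ℓ => Nat.log B (s.Q ℓ) + 1)
      then (B : ℝ) ^ t else 0 := by split_ifs <;> positivity
  rw [value, ← hr]
  rcases Nat.eq_zero_or_pos r with h0 | hpos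
  · rw [h0]
    simpa using add_nonneg (by positivity) hite
  rw [sum_tightVal hpos]
  by_cases hlt : r < B ^ (t - 1)
  · have : ((r + 1 : ℕ) : ℝ) ≤ ((B ^ (t - 1) : ℕ) : ℝ) := Nat.cast_le.2 hlt
    push_cast at this
    linarith
  have hrQ : r ≤ s.Q s.m := (alloc_le K s.toBidVec _).trans (min_le_left _ _)
  obtain ⟨ℓ, hℓ1, hℓm, hrℓ, -, hbid⟩ := s.exists_bid_eq hpos hrQ
  have h1 := (w_le_tightProfile K B t r).trans (le_bid_of_le_alloc hpos hr.le)
  rw [hbid, hs.2.2.2.2 ℓ hℓ1 hℓm, w_tightVal_le_iff (one_le_pow_sub_one hB ht)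
    (le_trans hpos hrℓ)] at h1
  have hBt : 0 < B ^ t := Nat.pow_pos (by omega)
  rw [if_pos]
  · have : ((r + 1 : ℕ) : ℝ) ≤ ((B ^ t : ℕ) : ℝ) := Nat.cast_le.2 (by omega)
    push_cast at this
    have : (0 : ℝ) ≤ (B : ℝ) ^ (t - 1) := by positivity
    linarith
  · refine Finset.mem_image.2 ⟨ℓ, Finset.mem_Icc.2 ⟨hℓ1, hℓm⟩, ?_⟩
    have : Nat.log B (s.Q ℓ) = t - 1 := by
      rw [Nat.log_eq_iff (Or.inr ⟨by omega, by omega⟩), Nat.sub_add_cancel ht]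
      omega
    omega

/-- The richer feasible strategy: the `ℓ`-th step bids `w (B ^ (2 ℓ - 1) - 1)`, up to a
cumulative quantity of `B ^ (2 ℓ) - 1`. -/
noncomputable def tightStrategy (B m : ℕ) : Uniform where
  m := m
  b ℓ := w tightVal (B ^ (2 * ℓ - 1) - 1)
  q ℓ := B ^ (2 * ℓ) - B ^ (2 * (ℓ - 1))

lemma Q_tightStrategy {B : ℕ} (hB : 1 ≤ B) (m ℓ : ℕ) :
    (tightStrategy B m).Q ℓ = B ^ (2 * ℓ) - 1 := by
  induction ℓ with
  | zero => simp [Uniform.Q]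
  | succ ℓ ih =>
    have h1 : B ^ (2 * ℓ) ≤ B ^ (2 * (ℓ + 1)) := Nat.pow_le_pow_right hB (by omega)
    have h2 : 0 < B ^ (2 * ℓ) := Nat.pow_pos hB
    unfold Uniform.Q at ih ⊢
    rw [Finset.sum_Icc_succ_top (by omega), ih]
    simp only [tightStrategy, Nat.add_sub_cancel]
    omega

lemma w_pow_le_iff {B t u : ℕ} (hB : 2 ≤ B) (ht : 1 ≤ t) (hu : 1 ≤ u) :
    w tightVal (B ^ t - 1) ≤ w tightVal (B ^ u - 1) ↔ u ≤ t := by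
  have h1 := one_le_pow_sub_one hB ht
  have h2 := one_le_pow_sub_one hB hu
  rw [w_tightVal_le_iff h1 h2, ← Nat.pow_le_pow_iff_right (a := B) (n := u) (by omega)]
  omega

/-- The bids of `tightStrategy` in terms of the step containing unit `j`. -/
lemma bid_tightStrategy {B m j : ℕ} (hB : 2 ≤ B) (h1 : 1 ≤ j) (hj : j < B ^ (2 * m)) :
    ∃ ℓ, 1 ≤ ℓ ∧ j < B ^ (2 * ℓ) ∧ (∀ k, j < B ^ (2 * k) → ℓ ≤ k) ∧
      (tightStrategy B m).toBidVec.bid j = w tightVal (B ^ (2 * ℓ - 1) - 1) := by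
  have hQ := Q_tightStrategy (B := B) (by omega) m
  have hpos : ∀ k, 0 < B ^ (2 * k) := fun k => Nat.pow_pos (by omega)
  obtain ⟨ℓ, hℓ1, -, hjℓ, hmin, hbid⟩ := (tightStrategy B m).exists_bid_eq h1
    (show j ≤ (tightStrategy B m).Q m by rw [hQ]; omega)
  refine ⟨ℓ, hℓ1, ?_, fun k hk => hmin k ?_, hbid⟩
  · rw [hQ] at hjℓ
    have := hpos ℓ
    omega
  · rw [hQ]
    omega

lemma alloc_tightStrategy {B m t : ℕ} (hB : 2 ≤ B) (ht : 1 ≤ t) (htm : t ≤ 2 * m) :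
    alloc (B ^ (2 * m)) (tightStrategy B m).toBidVec (tightProfile (B ^ (2 * m)) B t) =
      B ^ t - 1 := by
  have hle : B ^ t ≤ B ^ (2 * m) := Nat.pow_le_pow_right (by omega) htm
  have hBt : 1 ≤ B ^ t - 1 := one_le_pow_sub_one hB ht
  have hn : (tightStrategy B m).toBidVec.n = B ^ (2 * m) - 1 :=
    Q_tightStrategy (by omega) m m
  apply le_antisymm
  · by_contra! hlt
    have h1 : B ^ t ≤ alloc (B ^ (2 * m)) (tightStrategy B m).toBidVec
        (tightProfile (B ^ (2 * m)) B t) := by omega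
    have h2 := h1.trans (alloc_le _ _ _)
    rw [hn] at h2
    have h3 := le_bid_of_le_alloc (by omega) h1
    obtain ⟨ℓ, hℓ1, hjℓ, -, hbid⟩ := bid_tightStrategy (m := m) (j := B ^ t) hB (by omega)
      (by omega)
    rw [hbid] at h3
    rcases Nat.even_or_odd t with he | ho
    · have h4 := (w_le_tightProfile _ _ _ _).trans h3
      rw [w_pow_le_iff hB ht (by omega)] at h4
      rw [Nat.pow_lt_pow_iff_right (by omega)] at hjℓ
      obtain ⟨a, rfl⟩ := he
      omega
    · have h4 := w_tightVal_le_two (B ^ (2 * ℓ - 1) - 1)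
      simp only [tightProfile] at h3
      rw [if_pos ⟨ho, le_rfl⟩] at h3
      linarith
  · refine le_alloc (by rw [hn]; omega) fun j hj1 hj => ?_
    obtain ⟨ℓ, hℓ1, hjℓ, hmin, hbid⟩ := bid_tightStrategy (m := m) (j := j) hB hj1 (by omega)
    rw [tightProfile_of_lt (by omega), hbid, w_pow_le_iff hB ht (by omega)]
    have := hmin ((t + 1) / 2) (lt_of_lt_of_le (b := B ^ t) (by omega)
      (Nat.pow_le_pow_right (by omega) (by omega)))
    omega

lemma value_tightStrategy {B m t : ℕ} (hB : 2 ≤ B) (ht : 1 ≤ t) (htm : t ≤ 2 * m) :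
    value tightVal (B ^ (2 * m)) (tightStrategy B m).toBidVec
      (tightProfile (B ^ (2 * m)) B t) = (B : ℝ) ^ t := by
  have hBt : 1 ≤ B ^ t - 1 := one_le_pow_sub_one hB ht
  rw [value, alloc_tightStrategy hB ht htm, sum_tightVal hBt, Nat.cast_sub (by omega)]
  push_cast
  ring

lemma feasible_tightStrategy {B m t : ℕ} (hB : 2 ≤ B) (ht : 1 ≤ t) (htm : t ≤ 2 * m) :
    Feasible tightVal (B ^ (2 * m)) (tightStrategy B m).toBidVec
      (tightProfile (B ^ (2 * m)) B t) := by
  have hBt : 1 ≤ B ^ t - 1 := one_le_pow_sub_one hB ht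
  have hle : B ^ t ≤ B ^ (2 * m) := Nat.pow_le_pow_right (by omega) htm
  have halloc := alloc_tightStrategy hB ht htm
  have hprice : price (B ^ (2 * m)) (tightStrategy B m).toBidVec
      (tightProfile (B ^ (2 * m)) B t) ≤ w tightVal (B ^ t - 1) := by
    rw [price, halloc, if_neg (by omega), if_pos (by omega), Nat.sub_add_cancel (by omega)]
    rcases Nat.even_or_odd t with he | ho
    · refine (min_le_right _ _).trans (le_of_eq ?_)
      simp only [tightProfile]
      rw [if_neg (fun h => Nat.not_odd_iff_even.2 he h.1)]
    · refine (min_le_left _ _).trans ?_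
      obtain ⟨ℓ, hℓ1, hjℓ, -, hbid⟩ := bid_tightStrategy (m := m) (j := B ^ t - 1) hB hBt
        (by omega)
      rw [hbid, w_pow_le_iff hB (by omega) ht]
      have : B ^ t ≤ B ^ (2 * ℓ) := by omega
      rw [Nat.pow_le_pow_iff_right (by omega)] at this
      obtain ⟨a, rfl⟩ := ho
      omega
  have hcast : (0 : ℝ) < ((B ^ t - 1 : ℕ) : ℝ) := Nat.cast_pos.2 hBt
  rw [Feasible, payment, value, halloc]
  refine (mul_le_mul_of_nonneg_right hprice hcast.le).trans (le_of_eq ?_)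
  rw [w, div_mul_cancel₀ _ hcast.ne']

lemma isUniform_tightStrategy {B m : ℕ} (hB : 2 ≤ B) (hm : 1 ≤ m) :
    (tightStrategy B m).IsUniform (B ^ (2 * m) - 1) := by
  refine ⟨hm, fun j hj _ => ?_, ?_, fun j hj _ => ?_, (Q_tightStrategy (by omega) m m).le⟩
  · have : B ^ (2 * (j - 1)) < B ^ (2 * j) := Nat.pow_lt_pow_right (by omega) (by omega)
    simp only [tightStrategy]
    omega
  · exact w_tightVal_pos (one_le_pow_sub_one hB (by simp only [tightStrategy]; omega))
  · simp only [tightStrategy]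
    rw [← not_le, w_pow_le_iff hB (by omega) (by omega)]
    omega

lemma validValuation_tightVal (M : ℕ) : ValidValuation M tightVal := by
  refine ⟨fun j _ _ => ?_, fun i j hi hij _ => ?_⟩
  · unfold tightVal
    split_ifs <;> norm_num
  · unfold tightVal
    split_ifs with h1 h2
    · norm_num
    · omega
    · norm_num
    · norm_num

lemma inSafeClass_single {M m : ℕ} (hM : 1 ≤ M) (hm : 1 ≤ m) :
    InSafeClass M tightVal m (single 2 1) := by
  refine ⟨le_rfl, hm, fun _ _ _ => Nat.one_pos, by simpa [Uniform.Q, single] using hM, ?_⟩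
  intro ℓ h1 h2
  obtain rfl : ℓ = 1 := le_antisymm h2 h1
  norm_num [Uniform.Q, single, w, tightVal]

lemma value_single_pos {K B t : ℕ} (hK : 1 ≤ K) (hB : 2 ≤ B) (ht : 1 ≤ t) :
    0 < value tightVal K (single 2 1).toBidVec (tightProfile K B t) := by
  have h : 1 ≤ alloc K (single 2 1).toBidVec (tightProfile K B t) := by
    refine le_alloc (by simpa [Uniform.toBidVec, Uniform.Q, single] using hK) ?_
    intro j h1 h2
    have := one_le_pow_sub_one hB ht
    rw [tightProfile_of_lt (by omega)]
    exact w_tightVal_le_two _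
  rw [value, sum_tightVal h]
  positivity

/-- With type `t` occurring `B ^ (2 m - t)` times, safe strategies get at most
`m B ^ (2 m) + 2 m B ^ (2 m - 1)`. -/
lemma sum_value_safe_le {M K B m : ℕ} {s : Uniform} (hB : 2 ≤ B)
    (hs : InSafeClass M tightVal m s) :
    ∑ t ∈ Finset.Icc 1 (2 * m), ((B ^ (2 * m - t) : ℕ) : ℝ) *
      value tightVal K s.toBidVec (tightProfile K B t) ≤
      m * (B : ℝ) ^ (2 * m) + 2 * m * (B : ℝ) ^ (2 * m - 1) := by
  set I := (Finset.Icc 1 s.m).image (fun ℓ => Nat.log B (s.Q ℓ) + 1) with hI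
  have hcard : I.card ≤ m := by
    refine Finset.card_image_le.trans ?_
    simpa using hs.2.1
  calc _ ≤ ∑ t ∈ Finset.Icc 1 (2 * m),
        ((B : ℝ) ^ (2 * m - 1) + if t ∈ I then (B : ℝ) ^ (2 * m) else 0) := by
        refine Finset.sum_le_sum fun t ht => ?_
        rw [Finset.mem_Icc] at ht
        have e1 : (B : ℝ) ^ (2 * m - 1) = (B : ℝ) ^ (2 * m - t) * (B : ℝ) ^ (t - 1) := by
          rw [← pow_add]
          congr 1
          omega
        have e2 : (B : ℝ) ^ (2 * m) = (B : ℝ) ^ (2 * m - t) * (B : ℝ) ^ t := by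
          rw [← pow_add]
          congr 1
          omega
        refine (mul_le_mul_of_nonneg_left (value_safe_le hB ht.1 hs) (by positivity)).trans
          (le_of_eq ?_)
        rw [← hI, e1, e2, mul_add]
        push_cast
        split_ifs <;> simp
    _ = 2 * m * (B : ℝ) ^ (2 * m - 1) +
          (((Finset.Icc 1 (2 * m)).filter (· ∈ I)).card : ℝ) * (B : ℝ) ^ (2 * m) := by
        rw [Finset.sum_add_distrib, ← Finset.sum_filter]
        simp
    _ ≤ _ := by
        have : ((((Finset.Icc 1 (2 * m)).filter (· ∈ I)).card : ℕ) : ℝ) ≤ m :=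
          Nat.cast_le.2 ((Finset.card_le_card fun t ht => (Finset.mem_filter.1 ht).2).trans hcard)
        have := mul_le_mul_of_nonneg_right this (show (0 : ℝ) ≤ (B : ℝ) ^ (2 * m) by positivity)
        linarith

/-- Theorem `thm:Price_universal`, tightness: for every `m` and every
`δ ∈ (0, 1/2]` there is an instance (a valuation vector and a bid history) on which an
RoI-feasible strategy with at most `m` pairs obtains at least `(2 - δ)` times the
optimal safe value, which is positive. -/
theorem richness_feasible_tight
    (m : ℕ) (hm : 1 ≤ m) (δ : ℝ) (hδ0 : 0 < δ) (hδ : δ ≤ 1 / 2) :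
    ∃ (T K M : ℕ) (v : ℕ → ℝ) (H : ℕ → Profile K),
      1 ≤ T ∧ 1 ≤ K ∧ 1 ≤ M ∧ M ≤ K ∧ ValidValuation M v ∧
      0 < bestSafe M v K T H m ∧
      ∃ s : Uniform, InFeasClass M v K T H m s ∧
        (2 - δ) * bestSafe M v K T H m ≤ totalValue v K T H s := by
  obtain ⟨B, hBδ⟩ := exists_nat_ge (4 / δ)
  rw [div_le_iff₀ hδ0] at hBδ
  have hB : 2 ≤ B := by
    have : (2 : ℝ) ≤ B := by nlinarith [Nat.cast_nonneg (α := ℝ) B]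
    exact_mod_cast this
  obtain ⟨T, τ, hτ, hsum⟩ := exists_schedule (fun t => B ^ (2 * m - t)) (2 * m)
  have hT : 1 ≤ T := by
    by_contra! h
    obtain rfl : T = 0 := by omega
    have h1 := hsum fun _ => 1
    have h2 : (0 : ℝ) < ∑ t ∈ Finset.Icc 1 (2 * m), ((B ^ (2 * m - t) : ℕ) : ℝ) * 1 :=
      Finset.sum_pos (fun t _ => by positivity) ⟨1, Finset.mem_Icc.2 ⟨le_rfl, by omega⟩⟩
    simp only [← h1] at h2
    simp at h2
  have hM : 1 ≤ B ^ (2 * m) - 1 := one_le_pow_sub_one hB (by omega)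
  have hsafe : ∀ s, InSafeClass (B ^ (2 * m) - 1) tightVal m s →
      totalValue tightVal (B ^ (2 * m)) T (fun i => tightProfile (B ^ (2 * m)) B (τ i)) s ≤
      m * (B : ℝ) ^ (2 * m) + 2 * m * (B : ℝ) ^ (2 * m - 1) := by
    intro s hs
    rw [totalValue, hsum fun t =>
      value tightVal (B ^ (2 * m)) s.toBidVec (tightProfile (B ^ (2 * m)) B t)]
    exact sum_value_safe_le hB hs
  have hsingle := inSafeClass_single hM hm
  refine ⟨T, B ^ (2 * m), B ^ (2 * m) - 1, tightVal,
    fun i => tightProfile (B ^ (2 * m)) B (τ i), hT, by omega, hM, by omega,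
    validValuation_tightVal _, ?_, tightStrategy B m,
    ⟨isUniform_tightStrategy hB hm, le_rfl, ?_⟩, ?_⟩
  · refine lt_of_lt_of_le ?_ (le_csSup
      ⟨m * (B : ℝ) ^ (2 * m) + 2 * m * (B : ℝ) ^ (2 * m - 1), ?_⟩ ⟨single 2 1, hsingle, rfl⟩)
    · exact Finset.sum_pos (fun i hi => value_single_pos (by omega) hB
        (Finset.mem_Icc.1 (hτ i hi)).1) ⟨1, Finset.mem_Icc.2 ⟨le_rfl, hT⟩⟩
    · rintro x ⟨s, hs, rfl⟩
      exact hsafe s hs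
  · intro i hi
    have := Finset.mem_Icc.1 (hτ i hi)
    exact feasible_tightStrategy hB this.1 this.2
  · have hbest : bestSafe (B ^ (2 * m) - 1) tightVal (B ^ (2 * m)) T
        (fun i => tightProfile (B ^ (2 * m)) B (τ i)) m ≤
        m * (B : ℝ) ^ (2 * m) + 2 * m * (B : ℝ) ^ (2 * m - 1) := by
      refine csSup_le ⟨_, single 2 1, hsingle, rfl⟩ ?_
      rintro x ⟨s, hs, rfl⟩
      exact hsafe s hs
    have htot : totalValue tightVal (B ^ (2 * m)) T
        (fun i => tightProfile (B ^ (2 * m)) B (τ i)) (tightStrategy B m) =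
        2 * m * (B : ℝ) ^ (2 * m) := by
      rw [totalValue, hsum fun t => value tightVal (B ^ (2 * m)) (tightStrategy B m).toBidVec
        (tightProfile (B ^ (2 * m)) B t), Finset.sum_congr rfl
        (g := fun _ => (B : ℝ) ^ (2 * m))]
      · simp
      · intro t ht
        rw [Finset.mem_Icc] at ht
        rw [value_tightStrategy hB ht.1 ht.2]
        push_cast
        rw [← pow_add, Nat.sub_add_cancel ht.2]
    have hpow : (B : ℝ) ^ (2 * m) = (B : ℝ) ^ (2 * m - 1) * B := by
      rw [← pow_succ, Nat.sub_add_cancel (by omega)]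
    rw [htot]
    refine (mul_le_mul_of_nonneg_left hbest (by linarith)).trans ?_
    rw [hpow]
    have hc : (0 : ℝ) ≤ m * (B : ℝ) ^ (2 * m - 1) := by positivity
    nlinarith [mul_nonneg hc hδ0.le, mul_nonneg hc (sub_nonneg.2 hBδ)]

end Auction
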